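/- Assume P is irreducible, μ(k) > 0 for every k ∈ D, and R(i) = 0 for every i ∈ D. Then for every i ∈ D, σ_i² ≤ u(i)² · ∑_{k∈D} ∑_{ℓ∈[n], ℓ≠k} S^τ(k,ℓ) / (μ(k)·Q^τ(k,ℓ)²), where the right-hand side is evaluated in [0,+∞] with the conventions a/0 = +∞ for a > 0 and 0/0 = 0. -/

import Mathlib

open MeasureTheory Finset Filter
open scoped ENNReal NNReal ENat

noncomputable section

namespace RareTD

variable {n : ℕ}

/-- `P` is a row-stochastic matrix. -/
def IsStochastic (P : Matrix (Fin n) (Fin n) ℝ) : Prop :=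
  (∀ i j, 0 ≤ P i j) ∧ ∀ i, ∑ j, P i j = 1

/-- Irreducibility of a nonnegative matrix. -/
def IsIrreducible (P : Matrix (Fin n) (Fin n) ℝ) : Prop :=
  ∀ i j, ∃ m : ℕ, 0 < m ∧ 0 < (P ^ m) i j

/-- `Pr i` is the law of the Markov chain with transition matrix `P` started at `i`,
characterized by its finite-dimensional distributions. -/
def IsMarkovFamily (P : Matrix (Fin n) (Fin n) ℝ)
    (Pr : Fin n → Measure (ℕ → Fin n)) : Prop :=
  (∀ i, IsProbabilityMeasure (Pr i)) ∧
    ∀ (i : Fin n) (m : ℕ) (x : ℕ → Fin n),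
      (Pr i {ω | ∀ t ≤ m, ω t = x t}).toReal =
        (if x 0 = i then 1 else 0) * ∏ t ∈ Finset.range m, P (x t) (x (t + 1))

/-- The matrix `S` of the chain stopped on exiting `D`. -/
def stopMat (P : Matrix (Fin n) (Fin n) ℝ) (D : Finset (Fin n)) :
    Matrix (Fin n) (Fin n) ℝ :=
  fun i j => if i ∈ D then P i j else if i = j then 1 else 0

/-- Exit time `T = min {t ≥ 0 : ω t ∉ D}`, with value `⊤` if the path never leaves `D`. -/
def exitT (D : Finset (Fin n)) (ω : ℕ → Fin n) : ℕ∞ :=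
  ⨅ (t : ℕ) (_ : ω t ∉ D), (t : ℕ∞)

/-- Hitting time of a set at positive times, `min {t > 0 : ω t ∈ A}`. -/
def hitT (A : Set (Fin n)) (ω : ℕ → Fin n) : ℕ∞ :=
  ⨅ (t : ℕ) (_ : 0 < t ∧ ω t ∈ A), (t : ℕ∞)

/-- The stopped path `t ↦ X_{t ∧ T}`. -/
def stopped (D : Finset (Fin n)) (ω : ℕ → Fin n) : ℕ → Fin n
  | 0 => ω 0
  | t + 1 => if stopped D ω t ∈ D then ω (t + 1) else stopped D ω t

/-- `R_D`, the reward restricted to `D`. -/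
def RD (D : Finset (Fin n)) (R : Fin n → ℝ) : Fin n → ℝ := fun i => if i ∈ D then R i else 0

/-- The value function `u(i) = E_i[∑_{t=0}^{T} R(X_t)]`, in `[0,∞]`. -/
def valueE (Pr : Fin n → Measure (ℕ → Fin n)) (D : Finset (Fin n)) (R : Fin n → ℝ)
    (i : Fin n) : ℝ≥0∞ :=
  ∑' t : ℕ, ∫⁻ ω, Set.indicator {ω' : ℕ → Fin n | (t : ℕ∞) ≤ exitT D ω'}
      (fun ω' => ENNReal.ofReal (R (ω' t))) ω ∂(Pr i)

/-- The real-valued value function. -/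
def valueR (Pr : Fin n → Measure (ℕ → Fin n)) (D : Finset (Fin n)) (R : Fin n → ℝ)
    (i : Fin n) : ℝ := (valueE Pr D R i).toReal

/-- Replace by `0` every row and column with index outside `D`. -/
def zeroD (D : Finset (Fin n)) (M : Matrix (Fin n) (Fin n) ℝ) : Matrix (Fin n) (Fin n) ℝ :=
  fun i j => if i ∈ D ∧ j ∈ D then M i j else 0

/-- The asymptotic variance `σ_i²` of the LSTD estimator. -/
def avar (P : Matrix (Fin n) (Fin n) ℝ) (Pr : Fin n → Measure (ℕ → Fin n))
    (D : Finset (Fin n)) (R : Fin n → ℝ) (μ : Fin n → ℝ) (τ : ℕ) (i : Fin n) : ℝ :=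
  ∑ k ∈ D, (μ k)⁻¹ * ((((1 : Matrix (Fin n) (Fin n) ℝ) - zeroD D (stopMat P D ^ τ))⁻¹) i k) ^ 2 *
    ∫ ω, (∑ t ∈ Finset.range τ, RD D R (stopped D ω t)
        + valueR Pr D R (stopped D ω τ) - valueR Pr D R k) ^ 2 ∂(Pr k)

/-- Mean exit time `E_i[T] = ∑_{t≥0} P_i[T > t]`, in `[0,∞]`. -/
def meanExit (Pr : Fin n → Measure (ℕ → Fin n)) (D : Finset (Fin n)) (i : Fin n) : ℝ≥0∞ :=
  ∑' t : ℕ, Pr i {ω | (t : ℕ∞) < exitT D ω}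

/-- The event `T_ℓ^τ < min (T_k^τ, T_{Dᶜ∖{ℓ}}^τ)` for the `τ`-step chain. -/
def Qset (D : Finset (Fin n)) (k ℓ : Fin n) : Set (ℕ → Fin n) :=
  {ω | hitT {ℓ} ω < min (hitT {k} ω) (hitT ((D : Set (Fin n))ᶜ \ {ℓ}) ω)}

/-- Green's function of the `τ`-step chain: `E_i[∑_{t=0}^{T^τ-1} 1{Y_t^τ = k}]`. -/
def greenY (PrY : Fin n → Measure (ℕ → Fin n)) (D : Finset (Fin n)) (i k : Fin n) : ℝ≥0∞ :=
  ∑' t : ℕ, PrY i {ω | (t : ℕ∞) < exitT D ω ∧ ω t = k}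

/-- Green's function of the chain: `E_ℓ[∑_{t=0}^{T} 1{X_t = j}]` (the sum includes `t = T`). -/
def greenX (Pr : Fin n → Measure (ℕ → Fin n)) (D : Finset (Fin n)) (ℓ j : Fin n) : ℝ≥0∞ :=
  ∑' t : ℕ, Pr ℓ {ω | (t : ℕ∞) ≤ exitT D ω ∧ ω t = j}


section MarkovFamily

lemma measureReal_eq_sum_inter_preimage {Ω ι : Type*} [MeasurableSpace Ω] [Fintype ι]
    [MeasurableSpace ι] [MeasurableSingletonClass ι] (ν : Measure Ω) [IsFiniteMeasure ν]
    {f : Ω → ι} (hf : Measurable f) (s : Set Ω) :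
    ν.real s = ∑ x, ν.real (s ∩ f ⁻¹' {x}) := by
  have h := sum_measureReal_preimage_singleton (μ := ν.restrict s) (Finset.univ : Finset ι) (f := f)
    (fun y _ => hf (measurableSet_singleton y))
  simp only [Finset.coe_univ, Set.preimage_univ, measureReal_restrict_apply MeasurableSet.univ,
    Set.univ_inter] at h
  rw [← h]
  refine Finset.sum_congr rfl fun x _ => ?_
  rw [measureReal_restrict_apply (hf (measurableSet_singleton x)), Set.inter_comm]

variable {P : Matrix (Fin n) (Fin n) ℝ} {Pr : Fin n → Measure (ℕ → Fin n)}

lemma IsMarkovFamily.real_cylinder (hPr : IsMarkovFamily P Pr) (i : Fin n) (m : ℕ)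
    (x : ℕ → Fin n) :
    (Pr i).real {ω | ∀ t ≤ m, ω t = x t} =
      (if x 0 = i then 1 else 0) * ∏ t ∈ Finset.range m, P (x t) (x (t + 1)) :=
  hPr.2 i m x

lemma IsMarkovFamily.real_zero (hPr : IsMarkovFamily P Pr) (i b : Fin n) :
    (Pr i).real {ω | ω 0 = b} = (1 : Matrix (Fin n) (Fin n) ℝ) i b := by
  have h := hPr.real_cylinder i 0 (fun _ => b)
  simp only [Nat.le_zero, forall_eq, Finset.range_zero, Finset.prod_empty, mul_one] at h
  rw [h, Matrix.one_apply]
  simp only [eq_comm]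

/-- The Markov property for an event `B` that depends on the first `m + 1` coordinates only. -/
lemma IsMarkovFamily.real_inter_succ (hPr : IsMarkovFamily P Pr) (i : Fin n) (m : ℕ)
    (a b : Fin n) {B : Set (ℕ → Fin n)}
    (hB : ∀ ω ω' : ℕ → Fin n, (∀ t ≤ m, ω t = ω' t) → ω ∈ B → ω' ∈ B)
    (ha : ∀ ω ∈ B, ω m = a) :
    (Pr i).real (B ∩ {ω | ω (m + 1) = b}) = (Pr i).real B * P a b := by
  have := hPr.1 i
  let r : (ℕ → Fin n) → (Fin (m + 1) → Fin n) := fun ω t => ω t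
  have hr : Measurable r := measurable_pi_lambda _ fun t => measurable_pi_apply _
  rw [measureReal_eq_sum_inter_preimage (Pr i) hr, measureReal_eq_sum_inter_preimage (Pr i) hr B,
    Finset.sum_mul]
  refine Finset.sum_congr rfl fun x _ => ?_
  rcases (B ∩ r ⁻¹' {x}).eq_empty_or_nonempty with he | ⟨y, hyB, hyx⟩
  · rw [Set.inter_right_comm, he]
    simp
  have hrx : ∀ ω, r ω = x ↔ ∀ t ≤ m, ω t = y t := by
    intro ω
    rw [← (show r y = x from hyx)]
    constructor
    · intro h t ht
      exact congrFun h ⟨t, by omega⟩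
    · intro h
      funext t
      exact h t (by omega)
  have h1 : B ∩ r ⁻¹' {x} = {ω | ∀ t ≤ m, ω t = y t} := by
    ext ω
    simp only [Set.mem_inter_iff, Set.mem_preimage, Set.mem_singleton_iff, hrx, Set.mem_ofPred_eq]
    exact ⟨fun h => h.2, fun h => ⟨hB y ω (fun t ht => (h t ht).symm) hyB, h⟩⟩
  have h2 : B ∩ {ω | ω (m + 1) = b} ∩ r ⁻¹' {x}
      = {ω | ∀ t ≤ m + 1, ω t = Function.update y (m + 1) b t} := by
    rw [Set.inter_right_comm, h1]
    ext ω
    simp only [Set.mem_inter_iff, Set.mem_ofPred_eq]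
    constructor
    · rintro ⟨h, hb⟩ t ht
      rcases eq_or_ne t (m + 1) with rfl | hne
      · simpa using hb
      · rw [Function.update_of_ne hne]
        exact h t (by omega)
    · intro h
      refine ⟨fun t ht => ?_, by simpa using h (m + 1) le_rfl⟩
      have := h t (by omega)
      rwa [Function.update_of_ne (by omega)] at this
  rw [h1, h2, hPr.real_cylinder, hPr.real_cylinder, Finset.prod_range_succ, mul_assoc]
  congr 1
  rw [Function.update_of_ne (by omega : m ≠ m + 1), Function.update_self, ha y hyB]
  congr 1
  refine Finset.prod_congr rfl fun t ht => ?_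
  have := Finset.mem_range.mp ht
  rw [Function.update_of_ne (by omega), Function.update_of_ne (by omega)]

/-- One-step recursion for the law of the chain restricted to visiting prescribed sets. -/
lemma IsMarkovFamily.real_taboo_succ (hPr : IsMarkovFamily P Pr) (i : Fin n)
    (A : ℕ → Finset (Fin n)) (t : ℕ) (b : Fin n) :
    (Pr i).real {ω | (∀ s < t + 1, ω s ∈ A s) ∧ ω (t + 1) = b} =
      ∑ a ∈ A t, (Pr i).real {ω | (∀ s < t, ω s ∈ A s) ∧ ω t = a} * P a b := by
  have := hPr.1 i
  rw [measureReal_eq_sum_inter_preimage (Pr i) (measurable_pi_apply t),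
    ← Finset.sum_subset (Finset.subset_univ (A t))]
  · refine Finset.sum_congr rfl fun a ha => ?_
    rw [← hPr.real_inter_succ i t a b (B := {ω | (∀ s < t, ω s ∈ A s) ∧ ω t = a})]
    · congr 1
      ext ω
      simp only [Set.mem_inter_iff, Set.mem_ofPred_eq, Set.mem_preimage, Set.mem_singleton_iff,
        Nat.lt_succ_iff_lt_or_eq]
      constructor
      · rintro ⟨⟨h, hb⟩, hta⟩
        exact ⟨⟨fun s hs => h s (Or.inl hs), hta⟩, hb⟩
      · rintro ⟨⟨h, hta⟩, hb⟩
        refine ⟨⟨fun s hs => ?_, hb⟩, hta⟩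
        rcases hs with hs | rfl
        · exact h s hs
        · exact hta ▸ ha
    · rintro ω ω' h ⟨h1, h2⟩
      exact ⟨fun s hs => h s hs.le ▸ h1 s hs, h t le_rfl ▸ h2⟩
    · exact fun ω h => h.2
  · intro a _ ha
    convert measureReal_empty using 2
    ext ω
    simp only [Set.mem_inter_iff, Set.mem_ofPred_eq, Set.mem_preimage, Set.mem_singleton_iff,
      Set.mem_empty_iff_false, iff_false]
    rintro ⟨⟨h, _⟩, hta⟩
    exact ha (hta ▸ h t (Nat.lt_succ_self t))

end MarkovFamily

section Stopped

variable {P : Matrix (Fin n) (Fin n) ℝ} {Pr : Fin n → Measure (ℕ → Fin n)} {D : Finset (Fin n)}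

lemma measurable_stopped (D : Finset (Fin n)) (t : ℕ) : Measurable fun ω => stopped D ω t := by
  induction t with
  | zero => exact measurable_pi_apply 0
  | succ t ih =>
    have h : Measurable fun p : Fin n × Fin n => if p.1 ∈ D then p.2 else p.1 :=
      measurable_of_finite _
    exact h.comp (ih.prodMk (measurable_pi_apply (t + 1)))

lemma stopped_congr {ω ω' : ℕ → Fin n} {t : ℕ} (h : ∀ s ≤ t, ω s = ω' s) :
    stopped D ω t = stopped D ω' t := by
  induction t with
  | zero => exact h 0 le_rfl
  | succ t ih => simp only [stopped, ih fun s hs => h s (by omega), h (t + 1) le_rfl]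

lemma stopped_eq_of_mem {ω : ℕ → Fin n} {t : ℕ} (h : stopped D ω t ∈ D) :
    stopped D ω t = ω t := by
  cases t with
  | zero => rfl
  | succ t =>
    by_cases h' : stopped D ω t ∈ D
    · simp only [stopped, if_pos h']
    · simp only [stopped, if_neg h'] at h
      exact absurd h h'

/-- The stopped chain at time `t` started at `i` has law `S ^ t i ·`. -/
lemma IsMarkovFamily.real_stopped (hPr : IsMarkovFamily P Pr) (i : Fin n) (t : ℕ) (b : Fin n) :
    (Pr i).real {ω | stopped D ω t = b} = (stopMat P D ^ t) i b := by
  have := hPr.1 i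
  induction t generalizing b with
  | zero =>
    rw [pow_zero]
    exact hPr.real_zero i b
  | succ t ih =>
    rw [measureReal_eq_sum_inter_preimage (Pr i) (measurable_stopped D t), pow_succ,
      Matrix.mul_apply]
    refine Finset.sum_congr rfl fun a _ => ?_
    rw [← ih a]
    by_cases ha : a ∈ D
    · have hS : stopMat P D a b = P a b := if_pos ha
      rw [hS, ← hPr.real_inter_succ i t a b (B := {ω | stopped D ω t = a})]
      · congr 1
        ext ω
        simp only [Set.mem_inter_iff, Set.mem_ofPred_eq, Set.mem_preimage, Set.mem_singleton_iff,
          stopped]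
        constructor
        · rintro ⟨h, rfl⟩
          exact ⟨rfl, by simpa [ha] using h⟩
        · rintro ⟨rfl, h⟩
          exact ⟨by simpa [ha] using h, rfl⟩
      · rintro ω ω' h h1
        exact (stopped_congr h).symm.trans h1
      · rintro ω rfl
        exact (stopped_eq_of_mem ha).symm
    · have hS : stopMat P D a b = if a = b then 1 else 0 := if_neg ha
      rw [hS]
      split_ifs with hab
      · rw [mul_one]
        congr 1
        ext ω
        simp only [Set.mem_inter_iff, Set.mem_ofPred_eq, Set.mem_preimage, Set.mem_singleton_iff,
          stopped]
        constructor
        · exact fun h => h.2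
        · rintro rfl
          exact ⟨by rw [if_neg ha, hab], rfl⟩
      · rw [mul_zero]
        convert measureReal_empty using 2
        ext ω
        simp only [Set.mem_inter_iff, Set.mem_ofPred_eq, Set.mem_preimage, Set.mem_singleton_iff,
          stopped, Set.mem_empty_iff_false, iff_false]
        rintro ⟨h, rfl⟩
        rw [if_neg ha] at h
        exact hab h

lemma IsMarkovFamily.integral_stopped (hPr : IsMarkovFamily P Pr) (i : Fin n) (t : ℕ)
    (F : Fin n → ℝ) :
    ∫ ω, F (stopped D ω t) ∂(Pr i) = ∑ b, (stopMat P D ^ t) i b * F b := by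
  have := hPr.1 i
  have hm := measurable_stopped D t
  have := Measure.isProbabilityMeasure_map (μ := Pr i) hm.aemeasurable
  rw [← integral_map (f := F) hm.aemeasurable (measurable_of_finite F).aestronglyMeasurable,
    integral_fintype (.of_finite)]
  refine Finset.sum_congr rfl fun b _ => ?_
  rw [map_measureReal_apply hm (measurableSet_singleton b), ← hPr.real_stopped i t b, smul_eq_mul]
  rfl

end Stopped

section Harmonic

open Matrix

variable {M P : Matrix (Fin n) (Fin n) ℝ} {D : Finset (Fin n)}

lemma IsStochastic.one : IsStochastic (1 : Matrix (Fin n) (Fin n) ℝ) := by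
  refine ⟨fun i j => ?_, fun i => by simp [Matrix.one_apply]⟩
  rw [Matrix.one_apply]
  split_ifs <;> norm_num

lemma IsStochastic.mul (hM : IsStochastic M) (hP : IsStochastic P) : IsStochastic (M * P) := by
  refine ⟨fun i j => ?_, fun i => ?_⟩ <;> simp only [Matrix.mul_apply]
  · exact Finset.sum_nonneg fun a _ => mul_nonneg (hM.1 i a) (hP.1 a j)
  rw [Finset.sum_comm]
  simp only [← Finset.mul_sum, hP.2, mul_one, hM.2]

lemma IsStochastic.pow (hM : IsStochastic M) (m : ℕ) : IsStochastic (M ^ m) := by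
  induction m with
  | zero => exact pow_zero M ▸ IsStochastic.one
  | succ m ih => exact pow_succ M m ▸ ih.mul hM

lemma IsStochastic.mulVec_one (hM : IsStochastic M) : M *ᵥ 1 = 1 := by
  funext j
  simp [Matrix.mulVec, dotProduct, hM.2]

lemma stopMat_of_mem {j : Fin n} (hj : j ∈ D) (l : Fin n) : stopMat P D j l = P j l := if_pos hj

lemma stopMat_of_notMem {j : Fin n} (hj : j ∉ D) (l : Fin n) :
    stopMat P D j l = if j = l then 1 else 0 := if_neg hj

lemma IsStochastic.stopMat (hP : IsStochastic P) (D : Finset (Fin n)) :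
    IsStochastic (stopMat P D) := by
  constructor
  · intro i j
    by_cases hi : i ∈ D
    · exact stopMat_of_mem hi j ▸ hP.1 i j
    · rw [stopMat_of_notMem hi]
      split_ifs <;> norm_num
  · intro i
    by_cases hi : i ∈ D
    · simp only [stopMat_of_mem hi, hP.2]
    · simp [stopMat_of_notMem hi]

lemma stopMat_pow_apply_self {l : Fin n} (hl : l ∉ D) (p : ℕ) : (stopMat P D ^ p) l l = 1 := by
  induction p with
  | zero => simp
  | succ p ih =>
    rw [pow_succ', Matrix.mul_apply]
    simpa [stopMat_of_notMem hl] using ih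

lemma IsStochastic.mul_le_pow_add (hM : IsStochastic M) (p q : ℕ) (i a j : Fin n) :
    (M ^ p) i a * (M ^ q) a j ≤ (M ^ (p + q)) i j := by
  rw [pow_add, Matrix.mul_apply]
  exact Finset.single_le_sum
    (f := fun a => (M ^ p) i a * (M ^ q) a j)
    (fun a _ => mul_nonneg ((hM.pow p).1 i a) ((hM.pow q).1 a j)) (Finset.mem_univ a)

lemma exists_stopMat_pow_pos (hP : IsStochastic P) (m : ℕ) (j l : Fin n) (hl : l ∉ D)
    (h : 0 < (P ^ m) j l) : ∃ l' ∉ D, 0 < (stopMat P D ^ m) j l' := by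
  induction m generalizing j with
  | zero => exact ⟨l, hl, by simpa using h⟩
  | succ m ih =>
    by_cases hj : j ∈ D
    · rw [pow_succ', Matrix.mul_apply] at h
      obtain ⟨a, -, ha⟩ := Finset.exists_lt_of_sum_lt (s := Finset.univ)
        (f := fun _ => (0 : ℝ)) (by simpa using h)
      have h1 := pos_of_mul_pos_left ha ((hP.pow m).1 a l)
      have h2 := pos_of_mul_pos_right ha (hP.1 j a)
      obtain ⟨l', hl', hpos⟩ := ih a h2
      refine ⟨l', hl', lt_of_lt_of_le ?_ ((hP.stopMat D).mul_le_pow_add 1 m j a l' |>.trans_eq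
        (by rw [add_comm]))⟩
      rw [pow_one, stopMat_of_mem hj]
      exact mul_pos h1 hpos
    · exact ⟨j, hj, by rw [stopMat_pow_apply_self hj]; exact one_pos⟩

/-- Every state reaches the complement of `D` under the `τ`-step stopped chain. -/
lemma IsIrreducible.exists_stopMat_pow_pow_pos (hP : IsStochastic P) (hirr : IsIrreducible P)
    (hD : D ≠ Finset.univ) {τ : ℕ} (hτ : 1 ≤ τ) (j : Fin n) :
    ∃ m, ∃ l ∉ D, 0 < ((stopMat P D ^ τ) ^ m) j l := by
  obtain ⟨l, hl⟩ : ∃ l, l ∉ D := by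
    by_contra! h
    exact hD (Finset.eq_univ_iff_forall.mpr h)
  obtain ⟨m, -, hm⟩ := hirr j l
  obtain ⟨l', hl', hpos⟩ := exists_stopMat_pow_pos hP m j l hl hm
  refine ⟨m, l', hl', ?_⟩
  rw [← pow_mul]
  have h := (hP.stopMat D).mul_le_pow_add m (τ * m - m) j l' l'
  rw [stopMat_pow_apply_self hl', mul_one,
    Nat.add_sub_cancel' (Nat.le_mul_of_pos_left m hτ)] at h
  exact hpos.trans_le h

/-- Minimum principle for superharmonic functions. -/
lemma IsStochastic.nonneg_of_superharmonic (hM : IsStochastic M)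
    (hreach : ∀ j, ∃ m, ∃ l ∉ D, 0 < (M ^ m) j l) {D' : Finset (Fin n)} (hD' : D' ⊆ D)
    {f : Fin n → ℝ} (hf : ∀ j ∈ D', (M *ᵥ f) j ≤ f j) (hf0 : ∀ j ∉ D', 0 ≤ f j) (j : Fin n) :
    0 ≤ f j := by
  obtain ⟨z, -, hz⟩ := Finset.exists_min_image Finset.univ f ⟨j, Finset.mem_univ j⟩
  by_contra! hneg
  have hzneg : f z < 0 := (hz j (Finset.mem_univ j)).trans_lt hneg
  have hmin : ∀ a, f a = f z → a ∈ D' := fun a ha => by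
    by_contra h
    linarith [hf0 a h]
  have hstep : ∀ a, f a = f z → ∀ l, 0 < M a l → f l = f z := by
    intro a ha l hl
    have h1 : ∑ b, M a b * (f b - f z) ≤ 0 := by
      have := hf a (hmin a ha)
      simp only [Matrix.mulVec, dotProduct] at this
      simp only [mul_sub, Finset.sum_sub_distrib, ← Finset.sum_mul, hM.2]
      linarith
    have h2 : M a l * (f l - f z) ≤ ∑ b, M a b * (f b - f z) :=
      Finset.single_le_sum (f := fun b => M a b * (f b - f z))
        (fun b _ => mul_nonneg (hM.1 a b) (sub_nonneg.mpr (hz b (Finset.mem_univ b))))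
        (Finset.mem_univ l)
    have h3 : f l - f z ≤ 0 := nonpos_of_mul_nonpos_right (h2.trans h1) hl
    exact le_antisymm (by linarith) (hz l (Finset.mem_univ l))
  have hpow : ∀ m l, 0 < (M ^ m) z l → f l = f z := by
    intro m
    induction m with
    | zero =>
      intro l hl
      rw [pow_zero, Matrix.one_apply] at hl
      split_ifs at hl with h
      · rw [h]
      · exact absurd hl (lt_irrefl _)
    | succ m ih =>
      intro l hl
      rw [pow_succ, Matrix.mul_apply] at hl
      obtain ⟨a, -, ha⟩ := Finset.exists_lt_of_sum_lt (s := Finset.univ)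
        (f := fun _ => (0 : ℝ)) (by simpa using hl)
      exact hstep a (ih a (pos_of_mul_pos_left ha (hM.1 a l))) l
        (pos_of_mul_pos_right ha ((hM.pow m).1 z a))
  obtain ⟨m, l, hl, hpos⟩ := hreach z
  exact hl (hD' (hmin l (hpow m l hpos)))

lemma zeroD_mulVec_of_mem {f : Fin n → ℝ} (hf : ∀ j ∉ D, f j = 0) {j : Fin n} (hj : j ∈ D) :
    (zeroD D M *ᵥ f) j = (M *ᵥ f) j := by
  simp only [Matrix.mulVec, dotProduct]
  refine Finset.sum_congr rfl fun l _ => ?_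
  by_cases hl : l ∈ D
  · simp [zeroD, hj, hl]
  · simp [hf l hl]

lemma zeroD_mulVec_of_notMem (f : Fin n → ℝ) {j : Fin n} (hj : j ∉ D) :
    (zeroD D M *ᵥ f) j = 0 := by
  simp [Matrix.mulVec, dotProduct, zeroD, hj]

lemma IsStochastic.isUnit_det_one_sub_zeroD (hM : IsStochastic M)
    (hreach : ∀ j, ∃ m, ∃ l ∉ D, 0 < (M ^ m) j l) : IsUnit (1 - zeroD D M).det := by
  rw [isUnit_iff_ne_zero]
  intro hdet
  obtain ⟨x, hx, hMx⟩ := Matrix.exists_mulVec_eq_zero_iff.mpr hdet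
  rw [Matrix.sub_mulVec, Matrix.one_mulVec, sub_eq_zero] at hMx
  have h0 : ∀ j ∉ D, x j = 0 := fun j hj => by rw [hMx, zeroD_mulVec_of_notMem x hj]
  have h1 : ∀ j ∈ D, (M *ᵥ x) j = x j := fun j hj => by
    rw [← zeroD_mulVec_of_mem h0 hj, ← hMx]
  refine hx (funext fun j => le_antisymm ?_ ?_)
  · have := hM.nonneg_of_superharmonic hreach (Finset.Subset.refl D) (f := -x)
      (fun j hj => by rw [Matrix.mulVec_neg, Pi.neg_apply, Pi.neg_apply, h1 j hj])
      (fun j hj => by rw [Pi.neg_apply, h0 j hj, neg_zero]) j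
    simpa using this
  · exact hM.nonneg_of_superharmonic hreach (Finset.Subset.refl D)
      (fun j hj => (h1 j hj).le) (fun j hj => (h0 j hj).ge) j

/-- The Green function bound: for a nonnegative harmonic `u`, the oscillation of `u` along
`(k, l)`, weighted by the Green function and by any `q` that is bounded by the probability of
hitting `l` before returning to `k` or leaving `D`, is at most `u`. -/
lemma IsStochastic.green_mul_abs_sub_le (hM : IsStochastic M)
    (hreach : ∀ j, ∃ m, ∃ l ∉ D, 0 < (M ^ m) j l) {u : Fin n → ℝ} (hu : ∀ j, 0 ≤ u j)
    (hMu : M *ᵥ u = u) {k l : Fin n} (hk : k ∈ D) {q : ℝ}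
    (hq : ∀ f : Fin n → ℝ, (∀ j, 0 ≤ f j) →
      (∀ j ∈ D, j ≠ k → j ≠ l → (M *ᵥ f) j ≤ f j) → q * f l ≤ (M *ᵥ f) k)
    (hq0 : 0 ≤ q) (i : Fin n) :
    0 ≤ (1 - zeroD D M)⁻¹ i k ∧ (1 - zeroD D M)⁻¹ i k * (q * |u l - u k|) ≤ u i := by
  set g : Fin n → ℝ := fun j => (1 - zeroD D M)⁻¹ j k with hg
  have hgeq : ∀ j, g j - (zeroD D M *ᵥ g) j = (1 : Matrix (Fin n) (Fin n) ℝ) j k := by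
    intro j
    rw [← Matrix.mul_nonsing_inv _ (hM.isUnit_det_one_sub_zeroD hreach), Matrix.mul_apply]
    simp only [Matrix.sub_apply, sub_mul, Finset.sum_sub_distrib, Matrix.one_apply, ite_mul,
      one_mul, zero_mul, Finset.sum_ite_eq, Finset.mem_univ, if_true]
    rfl
  have hg0 : ∀ j ∉ D, g j = 0 := by
    intro j hj
    have h := hgeq j
    rwa [zeroD_mulVec_of_notMem g hj, sub_zero,
      Matrix.one_apply_ne (by rintro rfl; exact hj hk)] at h
  have hgk : (M *ᵥ g) k = g k - 1 := by
    have h := hgeq k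
    rw [zeroD_mulVec_of_mem hg0 hk, Matrix.one_apply_eq] at h
    linarith
  have hgh : ∀ j ∈ D, j ≠ k → (M *ᵥ g) j = g j := by
    intro j hj hjk
    have h := hgeq j
    rw [zeroD_mulVec_of_mem hg0 hj, Matrix.one_apply_ne hjk] at h
    linarith
  have hgnn : ∀ j, 0 ≤ g j := by
    refine hM.nonneg_of_superharmonic hreach (Finset.Subset.refl D) (fun j hj => ?_)
      (fun j hj => (hg0 j hj).ge)
    rcases eq_or_ne j k with rfl | hjk
    · linarith
    · exact (hgh j hj hjk).le
  have hgk1 : 1 ≤ g k := by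
    have : 0 ≤ (M *ᵥ g) k := by
      simp only [Matrix.mulVec, dotProduct]
      exact Finset.sum_nonneg fun l _ => mul_nonneg (hM.1 k l) (hgnn l)
    linarith
  have hcomb : ∀ (v : Fin n → ℝ) (c : ℝ) (j : Fin n),
      (M *ᵥ (v - c • g)) j = (M *ᵥ v) j - c * (M *ᵥ g) j := by
    intro v c j
    rw [Matrix.mulVec_sub, Matrix.mulVec_smul]
    rfl
  have hsuper : ∀ (v : Fin n → ℝ) (c : ℝ), M *ᵥ v = v → (∀ j, 0 ≤ v j) → 0 ≤ v k - c * g k →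
      ∀ j, 0 ≤ (v - c • g) j := by
    intro v c hMv hv hvk
    refine hM.nonneg_of_superharmonic hreach (Finset.erase_subset k D) (fun j hj => ?_)
      (fun j hj => ?_)
    · have hj' := Finset.mem_erase.mp hj
      rw [hcomb, hMv, hgh j hj'.2 hj'.1]
      rfl
    · rcases eq_or_ne j k with rfl | hjk
      · exact hvk
      · have hjD : j ∉ D := fun h => hj (Finset.mem_erase.mpr ⟨hjk, h⟩)
        simpa [hg0 j hjD] using hv j
  -- For harmonic `v ≥ 0`, compare `v` with the part of it carried by paths through `k`.
  have hkey : ∀ v : Fin n → ℝ, M *ᵥ v = v → (∀ j, 0 ≤ v j) →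
      0 ≤ v l - v k / g k * g l ∧ q * (v l - v k / g k * g l) ≤ v k / g k := by
    intro v hMv hv
    have hnn := hsuper v (v k / g k) hMv hv
      (by rw [div_mul_cancel₀ _ (by linarith : g k ≠ 0), sub_self])
    refine ⟨hnn l, (hq _ hnn fun j hj hjk _ => ?_).trans_eq ?_⟩
    · rw [hcomb, hMv, hgh j hj hjk]
      rfl
    · rw [hcomb, hMv, hgk, mul_sub, div_mul_cancel₀ _ (by linarith : g k ≠ 0)]
      ring
  obtain ⟨h1, h2⟩ := hkey u hMu hu
  obtain ⟨h3, h4⟩ := hkey 1 hM.mulVec_one (fun _ => zero_le_one)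
  simp only [Pi.one_apply] at h3 h4
  have hgkpos : 0 < g k := by linarith
  have huk : u k / g k = u k * (1 / g k) := by ring
  have hbound : q * |u l - u k| ≤ u k / g k := by
    rw [huk] at h1 h2 ⊢
    rcases abs_cases (u l - u k) with ⟨h, -⟩ | ⟨h, -⟩ <;> rw [h]
    · refine le_trans (mul_le_mul_of_nonneg_left ?_ hq0) h2
      nlinarith [hu k]
    · refine le_trans (mul_le_mul_of_nonneg_left ?_ hq0)
        ((mul_left_comm q (u k) _).trans_le (mul_le_mul_of_nonneg_left h4 (hu k)))
      nlinarith [hu k]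
  refine ⟨hgnn i, ?_⟩
  have := hsuper u (q * |u l - u k|) hMu hu (by
    rw [le_div_iff₀ hgkpos] at hbound
    linarith) i
  simp only [Pi.sub_apply, Pi.smul_apply, smul_eq_mul] at this
  rw [mul_comm]
  linarith

end Harmonic

section Value

open Matrix

variable {P : Matrix (Fin n) (Fin n) ℝ} {Pr : Fin n → Measure (ℕ → Fin n)} {D : Finset (Fin n)}
  {R : Fin n → ℝ}

lemma coe_le_exitT_iff {ω : ℕ → Fin n} {t : ℕ} : (t : ℕ∞) ≤ exitT D ω ↔ ∀ s < t, ω s ∈ D := by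
  simp only [exitT, le_iInf_iff, Nat.cast_le]
  exact forall_congr' fun s => by rw [← not_imp_not, not_le, not_not]

/-- The matrix `P` killed outside `D`. -/
def killMat (P : Matrix (Fin n) (Fin n) ℝ) (D : Finset (Fin n)) : Matrix (Fin n) (Fin n) ℝ :=
  fun i j => if i ∈ D then P i j else 0

lemma IsStochastic.killMat_nonneg (hP : IsStochastic P) (i j : Fin n) : 0 ≤ killMat P D i j := by
  unfold killMat
  split_ifs
  exacts [hP.1 i j, le_rfl]

lemma IsMarkovFamily.real_kill (hPr : IsMarkovFamily P Pr) (i : Fin n) (t : ℕ) (b : Fin n) :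
    (Pr i).real {ω | (∀ s < t, ω s ∈ D) ∧ ω t = b} = (killMat P D ^ t) i b := by
  induction t generalizing b with
  | zero =>
    rw [pow_zero, ← hPr.real_zero i b]
    simp
  | succ t ih =>
    rw [hPr.real_taboo_succ i (fun _ => D) t b, pow_succ, Matrix.mul_apply,
      ← Finset.sum_subset (Finset.subset_univ D)]
    · refine Finset.sum_congr rfl fun a ha => ?_
      rw [ih a, killMat, if_pos ha]
    · intro a _ ha
      rw [killMat, if_neg ha, mul_zero]

lemma IsStochastic.killMat_pow_mulVec_nonneg (hP : IsStochastic P) (hR : ∀ i, 0 ≤ R i) (t : ℕ)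
    (i : Fin n) : 0 ≤ ((killMat P D ^ t) *ᵥ R) i := by
  induction t generalizing i with
  | zero => simpa using hR i
  | succ t ih =>
    rw [pow_succ', ← Matrix.mulVec_mulVec, Matrix.mulVec, dotProduct]
    exact Finset.sum_nonneg fun j _ => mul_nonneg (hP.killMat_nonneg i j) (ih j)

lemma IsMarkovFamily.valueE_eq_tsum (hPr : IsMarkovFamily P Pr) (hR : ∀ i, 0 ≤ R i)
    (i : Fin n) :
    valueE Pr D R i = ∑' t : ℕ, ENNReal.ofReal (((killMat P D ^ t) *ᵥ R) i) := by
  have := hPr.1 i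
  refine tsum_congr fun t => ?_
  have hset : {ω : ℕ → Fin n | (t : ℕ∞) ≤ exitT D ω} = {ω | ∀ s < t, ω s ∈ D} :=
    Set.ext fun ω => coe_le_exitT_iff
  have hmeas : MeasurableSet {ω : ℕ → Fin n | ∀ s < t, ω s ∈ D} := by
    have : {ω : ℕ → Fin n | ∀ s < t, ω s ∈ D} = ⋂ s < t, (fun ω : ℕ → Fin n => ω s) ⁻¹' D := by
      ext ω
      simp
    rw [this]
    exact .iInter fun s => .iInter fun _ => measurable_pi_apply s (Set.toFinite _).measurableSet
  have hev : Measurable fun ω : ℕ → Fin n => ω t := measurable_pi_apply t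
  rw [hset, lintegral_indicator hmeas,
    ← lintegral_map (f := fun b => ENNReal.ofReal (R b)) (measurable_of_finite _) hev,
    lintegral_fintype]
  simp only [Matrix.mulVec, dotProduct]
  rw [ENNReal.ofReal_sum_of_nonneg fun b _ => by
    rw [← hPr.real_kill i t b]
    exact mul_nonneg measureReal_nonneg (hR b)]
  refine Finset.sum_congr rfl fun b _ => ?_
  rw [Measure.map_apply hev (measurableSet_singleton b),
    Measure.restrict_apply (hev (measurableSet_singleton b)), mul_comm ((killMat P D ^ t) i b),
    ENNReal.ofReal_mul (hR b), ← hPr.real_kill i t b, ofReal_measureReal]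
  congr 2
  ext ω
  simp [and_comm]

lemma IsStochastic.sum_killMat_pow_mulVec_le (hP : IsStochastic P) (hR : ∀ i, 0 ≤ R i)
    (hRD : ∀ i ∈ D, R i = 0) (N : ℕ) (i : Fin n) :
    ∑ t ∈ Finset.range N, ((killMat P D ^ t) *ᵥ R) i ≤ ∑ j, R j := by
  induction N generalizing i with
  | zero => simpa using Finset.sum_nonneg fun j _ => hR j
  | succ N ih =>
    have hs : ∑ t ∈ Finset.range N, ((killMat P D ^ (t + 1)) *ᵥ R) i
        = ∑ j, killMat P D i j * ∑ t ∈ Finset.range N, ((killMat P D ^ t) *ᵥ R) j := by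
      simp only [pow_succ', ← Matrix.mulVec_mulVec, Finset.mul_sum]
      rw [Finset.sum_comm]
      rfl
    rw [Finset.sum_range_succ', hs, pow_zero, Matrix.one_mulVec]
    by_cases hi : i ∈ D
    · rw [hRD i hi, add_zero]
      calc _ ≤ ∑ j, killMat P D i j * ∑ j, R j :=
            Finset.sum_le_sum fun j _ => mul_le_mul_of_nonneg_left (ih j) (hP.killMat_nonneg i j)
        _ = ∑ j, R j := by
            rw [← Finset.sum_mul]
            simp [killMat, hi, hP.2]
    · have h0 : ∀ j, killMat P D i j = 0 := fun j => if_neg hi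
      simpa [h0] using Finset.single_le_sum (fun j _ => hR j) (Finset.mem_univ i)

lemma valueR_nonneg (i : Fin n) : 0 ≤ valueR Pr D R i := ENNReal.toReal_nonneg

/-- When the reward vanishes on `D`, the value function is harmonic for the stopped chain. -/
lemma IsMarkovFamily.stopMat_mulVec_valueR (hP : IsStochastic P) (hPr : IsMarkovFamily P Pr)
    (hR : ∀ i, 0 ≤ R i) (hRD : ∀ i ∈ D, R i = 0) :
    stopMat P D *ᵥ valueR Pr D R = valueR Pr D R := by
  set a : ℕ → Fin n → ℝ := fun t i => ((killMat P D ^ t) *ᵥ R) i with ha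
  have hnn : ∀ t i, 0 ≤ a t i := fun t i => hP.killMat_pow_mulVec_nonneg hR t i
  have hsum : ∀ i, Summable fun t => a t i := fun i =>
    summable_of_sum_range_le (fun t => hnn t i)
      (fun N => hP.sum_killMat_pow_mulVec_le hR hRD N i)
  have hval : ∀ i, valueR Pr D R i = ∑' t, a t i := fun i => by
    rw [valueR, hPr.valueE_eq_tsum hR, ← ENNReal.ofReal_tsum_of_nonneg (fun t => hnn t i) (hsum i),
      ENNReal.toReal_ofReal (tsum_nonneg fun t => hnn t i)]
  funext i
  simp only [Matrix.mulVec, dotProduct]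
  by_cases hi : i ∈ D
  · rw [hval i, (hsum i).tsum_eq_zero_add]
    have h0 : a 0 i = 0 := by simp [ha, hRD i hi]
    have h1 : ∀ t, a (t + 1) i = ∑ j, P i j * a t j := fun t => by
      simp only [ha, pow_succ', ← Matrix.mulVec_mulVec]
      simp [Matrix.mulVec, dotProduct, killMat, hi]
    simp only [h0, h1, zero_add]
    rw [Summable.tsum_finsetSum fun j _ => (hsum j).mul_left (P i j)]
    exact Finset.sum_congr rfl fun j _ => by rw [stopMat_of_mem hi, tsum_mul_left, hval j]
  · simp [stopMat_of_notMem hi]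

lemma pow_mulVec_eq_self {M : Matrix (Fin n) (Fin n) ℝ} {u : Fin n → ℝ} (h : M *ᵥ u = u)
    (m : ℕ) : M ^ m *ᵥ u = u := by
  induction m with
  | zero => rw [pow_zero, Matrix.one_mulVec]
  | succ m ih => rw [pow_succ, ← Matrix.mulVec_mulVec, h, ih]

end Value

section Hitting

open Matrix

variable {M : Matrix (Fin n) (Fin n) ℝ} {Pr : Fin n → Measure (ℕ → Fin n)} {D : Finset (Fin n)}
  {k l : Fin n}

lemma coe_lt_min_hitT {ω : ℕ → Fin n} {t s : ℕ}
    (h : (t : ℕ∞) < min (hitT {k} ω) (hitT ((D : Set (Fin n))ᶜ \ {l}) ω)) (hs : 0 < s)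
    (hst : s ≤ t) : ω s ≠ k ∧ (ω s ∉ D → ω s = l) := by
  rw [lt_min_iff] at h
  constructor
  · intro hk
    have : hitT {k} ω ≤ s := iInf₂_le s ⟨hs, hk⟩
    exact absurd (Nat.cast_lt.mp (h.1.trans_le this)) (by omega)
  · intro hD
    by_contra hl
    have : hitT ((D : Set (Fin n))ᶜ \ {l}) ω ≤ s := iInf₂_le s ⟨hs, by simpa using hD, hl⟩
    exact absurd (Nat.cast_lt.mp (h.2.trans_le this)) (by omega)

/-- The states allowed at time `s` for a path realising `Qset D k l` that has not yet hit `l`. -/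
def tabooSet (D : Finset (Fin n)) (k l : Fin n) (s : ℕ) : Finset (Fin n) :=
  if s = 0 then Finset.univ else (D.erase k).erase l

lemma Qset_subset : Qset D k l ⊆
    ⋃ t : ℕ, {ω | (∀ s < t + 1, ω s ∈ tabooSet D k l s) ∧ ω (t + 1) = l} := by
  intro ω hω
  have hlt : hitT {l} ω < min (hitT {k} ω) (hitT ((D : Set (Fin n))ᶜ \ {l}) ω) := hω
  rw [hitT] at hlt
  simp only [iInf_lt_iff] at hlt
  obtain ⟨t, ⟨ht, htl⟩, hlt⟩ := hlt
  have hex : ∃ t, 0 < t ∧ ω t = l := ⟨t, ht, htl⟩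
  classical
  obtain ⟨h0, hl⟩ := Nat.find_spec hex
  have hle : Nat.find hex ≤ t := Nat.find_min' hex ⟨ht, htl⟩
  have hmin : ∀ s < Nat.find hex, 0 < s → ω s ≠ l := fun s hs h0 h => Nat.find_min hex hs ⟨h0, h⟩
  generalize Nat.find hex = r at *
  obtain ⟨r, rfl⟩ := Nat.exists_eq_succ_of_ne_zero h0.ne'
  refine Set.mem_iUnion.mpr ⟨r, fun s hs => ?_, hl⟩
  rcases Nat.eq_zero_or_pos s with rfl | hs0
  · simp [tabooSet]
  · obtain ⟨h1, h2⟩ := coe_lt_min_hitT hlt hs0 (by omega)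
    have hsl := hmin s hs hs0
    simp only [tabooSet, if_neg hs0.ne', Finset.mem_erase]
    exact ⟨hsl, h1, by_contra fun h => hsl (h2 h)⟩

lemma IsMarkovFamily.real_taboo_one (hPr : IsMarkovFamily M Pr) (b : Fin n) :
    (Pr k).real {ω | (∀ s < 0 + 1, ω s ∈ tabooSet D k l s) ∧ ω (0 + 1) = b} = M k b := by
  rw [hPr.real_taboo_succ]
  simp [tabooSet, hPr.real_zero, Matrix.one_apply]

/-- `P_k[Qset D k l] * f l` is at most the one-step average of any nonnegative `f` that is
superharmonic on `D ∖ {k, l}`. -/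
lemma IsMarkovFamily.real_Qset_mul_le (hM : IsStochastic M) (hPr : IsMarkovFamily M Pr)
    {f : Fin n → ℝ} (hf : ∀ j, 0 ≤ f j)
    (hsuper : ∀ j ∈ D, j ≠ k → j ≠ l → (M *ᵥ f) j ≤ f j) :
    (Pr k).real (Qset D k l) * f l ≤ (M *ᵥ f) k := by
  have := hPr.1 k
  set p : ℕ → Fin n → ℝ := fun t b =>
    (Pr k).real {ω | (∀ s < t + 1, ω s ∈ tabooSet D k l s) ∧ ω (t + 1) = b} with hp
  set A : Finset (Fin n) := (D.erase k).erase l with hA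
  have hpnn : ∀ t b, 0 ≤ p t b := fun t b => measureReal_nonneg
  have hp0 : ∀ b, p 0 b = M k b := fun b => hPr.real_taboo_one b
  have hpsucc : ∀ t b, p (t + 1) b = ∑ a ∈ A, p t a * M a b := fun t b =>
    hPr.real_taboo_succ k (tabooSet D k l) (t + 1) b
  have hsplit : ∀ c : Fin n → ℝ, (∀ b, 0 ≤ c b) →
      c l * f l + ∑ b ∈ A, c b * f b ≤ ∑ b, c b * f b := by
    intro c hc
    rw [← Finset.sum_insert (Finset.notMem_erase l (D.erase k)) (f := fun b => c b * f b)]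
    exact Finset.sum_le_sum_of_subset_of_nonneg (Finset.subset_univ _)
      fun b _ _ => mul_nonneg (hc b) (hf b)
  have hpart : ∀ N, (∑ t ∈ Finset.range (N + 1), p t l) * f l + ∑ b ∈ A, p N b * f b
      ≤ (M *ᵥ f) k := by
    intro N
    induction N with
    | zero =>
      rw [Finset.sum_range_one]
      refine (hsplit (p 0) (hpnn 0)).trans_eq ?_
      simp only [hp0]
      rfl
    | succ N ih =>
      have h1 : ∑ b, p (N + 1) b * f b ≤ ∑ a ∈ A, p N a * f a := by
        calc ∑ b, p (N + 1) b * f b = ∑ a ∈ A, p N a * (M *ᵥ f) a := by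
              simp only [hpsucc, Matrix.mulVec, dotProduct, Finset.sum_mul, Finset.mul_sum]
              rw [Finset.sum_comm]
              simp only [mul_assoc]
          _ ≤ _ := Finset.sum_le_sum fun a ha => by
              simp only [hA, Finset.mem_erase] at ha
              exact mul_le_mul_of_nonneg_left (hsuper a ha.2.2 ha.2.1 ha.1) (hpnn N a)
      have h2 := hsplit (p (N + 1)) (hpnn (N + 1))
      rw [Finset.sum_range_succ, add_mul]
      linarith
  have hMf : 0 ≤ (M *ᵥ f) k := by
    simp only [Matrix.mulVec, dotProduct]
    exact Finset.sum_nonneg fun j _ => mul_nonneg (hM.1 k j) (hf j)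
  rcases (hf l).eq_or_lt with h0 | hpos
  · rwa [← h0, mul_zero]
  rw [← le_div_iff₀ hpos]
  refine ENNReal.toReal_le_of_le_ofReal (div_nonneg hMf hpos.le) ?_
  refine (measure_mono Qset_subset).trans ((measure_iUnion_le _).trans ?_)
  refine ENNReal.tsum_le_of_sum_range_le fun N => ?_
  have hconv : ∀ t, Pr k {ω | (∀ s < t + 1, ω s ∈ tabooSet D k l s) ∧ ω (t + 1) = l}
      = ENNReal.ofReal (p t l) := fun t => (ofReal_measureReal).symm
  simp only [hconv]
  rw [← ENNReal.ofReal_sum_of_nonneg fun t _ => hpnn t l]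
  refine ENNReal.ofReal_le_ofReal ?_
  rw [le_div_iff₀ hpos]
  have h1 := hpart N
  have h2 : 0 ≤ ∑ b ∈ A, p N b * f b := Finset.sum_nonneg fun b _ => mul_nonneg (hpnn N b) (hf b)
  rw [Finset.sum_range_succ, add_mul] at h1
  have h3 := mul_nonneg (hpnn N l) (hf l)
  linarith

lemma IsMarkovFamily.le_real_Qset (hPr : IsMarkovFamily M Pr) (hlk : l ≠ k) :
    M k l ≤ (Pr k).real (Qset D k l) := by
  have := hPr.1 k
  rw [← hPr.real_taboo_one (D := D) (l := l) l]
  refine measureReal_mono ?_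
  rintro ω ⟨-, hl⟩
  have htwo : ∀ B : Set (Fin n), l ∉ B → (2 : ℕ) ≤ hitT B ω := fun B hB =>
    le_iInf₂ fun s hs => Nat.cast_le.mpr (by
      rcases Nat.lt_or_ge s 2 with h | h
      · obtain rfl : s = 0 + 1 := by have := hs.1; omega
        exact absurd (hl ▸ hs.2) hB
      · exact h)
  have hone : hitT {l} ω ≤ (1 : ℕ) := iInf₂_le 1 ⟨one_pos, hl⟩
  refine (hone.trans_lt (Nat.cast_lt.mpr one_lt_two)).trans_le (le_min (htwo _ ?_) (htwo _ ?_))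
  · simpa using hlk
  · simp

end Hitting

/-- Corollary 1 of the paper: when the reward vanishes on `D`,
`σ_i² ≤ u(i)² ∑_{k∈D} ∑_{ℓ≠k} S^τ(k,ℓ) / (μ(k) Q^τ(k,ℓ)²)`, the right-hand side being
computed in `[0,∞]` (so that `a/0 = ∞` for `a > 0` and `0/0 = 0`). -/
theorem stmt5 {n : ℕ} (hn : 2 ≤ n) (D : Finset (Fin n)) (hD : D.Nonempty)
    (hDne : D ≠ Finset.univ)
    (P : Matrix (Fin n) (Fin n) ℝ) (hP : IsStochastic P) (hirr : IsIrreducible P)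
    (R : Fin n → ℝ) (hR : ∀ i, 0 ≤ R i) (hRD : ∀ i ∈ D, R i = 0)
    (τ : ℕ) (hτ : 1 ≤ τ)
    (μ : Fin n → ℝ) (hμ0 : ∀ i, 0 ≤ μ i) (hμ1 : ∑ i, μ i = 1)
    (hμsupp : ∀ i ∉ D, μ i = 0) (hμpos : ∀ k ∈ D, 0 < μ k)
    (Pr : Fin n → Measure (ℕ → Fin n)) (hPr : IsMarkovFamily P Pr)
    -- the law of the `τ`-step chain `Y^τ`, with transition matrix `S^τ`
    (PrY : Fin n → Measure (ℕ → Fin n)) (hPrY : IsMarkovFamily (stopMat P D ^ τ) PrY)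
    (i : Fin n) (hi : i ∈ D) :
    ENNReal.ofReal (avar P Pr D R μ τ i)
      ≤ ENNReal.ofReal ((valueR Pr D R i) ^ 2) *
          ∑ k ∈ D, ∑ ℓ ∈ ({k}ᶜ : Finset (Fin n)),
            ENNReal.ofReal ((stopMat P D ^ τ) k ℓ) /
              (ENNReal.ofReal (μ k) * (PrY k (Qset D k ℓ)) ^ 2) := by
  have hS := hP.stopMat D
  set M := stopMat P D ^ τ with hMdef
  have hM : IsStochastic M := hS.pow τ
  have hreach : ∀ j, ∃ m, ∃ l ∉ D, 0 < (M ^ m) j l :=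
    fun j => hirr.exists_stopMat_pow_pow_pos hP hDne hτ j
  set u : Fin n → ℝ := valueR Pr D R with hudef
  have hu : ∀ j, 0 ≤ u j := fun j => valueR_nonneg j
  have hMu : M.mulVec u = u := pow_mulVec_eq_self (hPr.stopMat_mulVec_valueR hP hR hRD) τ
  have hRD0 : ∀ j, RD D R j = 0 := fun j => by
    unfold RD
    split_ifs with h
    exacts [hRD j h, rfl]
  have havar : avar P Pr D R μ τ i = ∑ k ∈ D, ∑ ℓ ∈ ({k}ᶜ : Finset (Fin n)),
      (μ k)⁻¹ * ((1 - zeroD D M)⁻¹ i k) ^ 2 * (M k ℓ * (u ℓ - u k) ^ 2) := by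
    refine Finset.sum_congr rfl fun k _ => ?_
    simp only [hRD0, Finset.sum_const_zero, zero_add]
    rw [hPr.integral_stopped k τ fun ℓ => (u ℓ - u k) ^ 2, ← Finset.mul_sum,
      ← Finset.sum_subset (Finset.subset_univ ({k}ᶜ : Finset (Fin n)))]
    intro ℓ _ hℓ
    obtain rfl : ℓ = k := by simpa using hℓ
    simp
  have hnn : ∀ k ∈ D, ∀ ℓ, 0 ≤ (μ k)⁻¹ * ((1 - zeroD D M)⁻¹ i k) ^ 2 * (M k ℓ * (u ℓ - u k) ^ 2) :=
    fun k hk ℓ => mul_nonneg (mul_nonneg (inv_nonneg.mpr (hμ0 k)) (sq_nonneg _))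
      (mul_nonneg (hM.1 k ℓ) (sq_nonneg _))
  rw [havar, ENNReal.ofReal_sum_of_nonneg fun k hk => Finset.sum_nonneg fun ℓ _ => hnn k hk ℓ,
    Finset.mul_sum]
  refine Finset.sum_le_sum fun k hk => ?_
  rw [ENNReal.ofReal_sum_of_nonneg fun ℓ _ => hnn k hk ℓ, Finset.mul_sum]
  refine Finset.sum_le_sum fun ℓ hℓ => ?_
  have hℓk : ℓ ≠ k := by simpa using hℓ
  rcases (hM.1 k ℓ).eq_or_lt with h0 | hpos
  · simp [← h0]
  have := hPrY.1 k
  set q := (PrY k).real (Qset D k ℓ) with hq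
  have hqpos : 0 < q := hpos.trans_le (hPrY.le_real_Qset hℓk)
  obtain ⟨hg, hgle⟩ := hM.green_mul_abs_sub_le hreach hu hMu (l := ℓ) hk
    (fun f hf hsuper => hPrY.real_Qset_mul_le hM hf hsuper) measureReal_nonneg i
  have hμk := hμpos k hk
  rw [← ofReal_measureReal (μ := PrY k) (s := Qset D k ℓ), ← hq,
    ← ENNReal.ofReal_pow hqpos.le, ← ENNReal.ofReal_mul hμk.le,
    ← ENNReal.ofReal_div_of_pos (by positivity), ← ENNReal.ofReal_mul (sq_nonneg _)]
  refine ENNReal.ofReal_le_ofReal ?_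
  have hsq := pow_le_pow_left₀ (mul_nonneg hg (mul_nonneg hqpos.le (abs_nonneg _))) hgle 2
  rw [mul_pow, mul_pow, sq_abs] at hsq
  rw [mul_div_assoc', le_div_iff₀ (by positivity)]
  calc _ = ((1 - zeroD D M)⁻¹ i k ^ 2 * (q ^ 2 * (u ℓ - u k) ^ 2)) * M k ℓ := by
        field_simp
    _ ≤ _ := mul_le_mul_of_nonneg_right hsq hpos.le

end RareTD
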